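/- Let m ≥ 2 and a ≥ 1, and let a_{m+1},…,a_n be the level-m expansion of a. Then max(2, C(π^(m+1)(1, χ^(m+1)(a)))) = max(2, maxdigit_{m+1}(a_{m+1}), maxdigit_{m+2}(a_{m+2}), …, maxdigit_n(a_n)). Moreover, a lies in the image of ι_m (equivalently, C(π^(m+1)(1, χ^(m+1)(a))) ≤ m) if and only if maxdigit_l(a_l) ≤ m for every l with m+1 ≤ l ≤ n. -/

import Mathlib

open List Filter

open scoped Classical

noncomputable section

/-- The curling number of a finite string: the largest `k` such that
`S = X ++ Y^k` with `Y` nonempty; by convention `curl [] = 1`. -/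
def curl (S : List ℕ) : ℕ :=
  max 1 (sSup {k | ∃ X Y : List ℕ, Y ≠ [] ∧ S = X ++ (List.replicate k Y).flatten})

/-- The prefix of length `n` of the level-`m` Gijswijt sequence `A^(m)`. -/
def gPrefix (m : ℕ) : ℕ → List ℕ
  | 0 => []
  | n + 1 => gPrefix m n ++ [max m (curl (gPrefix m n))]

/-- `gij m p` is the `p`-th term (1-indexed) of the level-`m` Gijswijt sequence `A^(m)`. -/
def gij (m p : ℕ) : ℕ := max m (curl (gPrefix m (p - 1)))

/-- Standing hypothesis: for every `m ≥ 1`, the sets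
`{k ≥ 0 : C(A^(m)[1,k]) ≤ m}` and `{k ≥ 0 : C(A^(m+1)[1,k]) ≤ m}` are infinite. -/
def StandingHyp : Prop :=
  ∀ m : ℕ, 1 ≤ m →
    {k : ℕ | curl (gPrefix m k) ≤ m}.Infinite ∧
    {k : ℕ | curl (gPrefix (m + 1) k) ≤ m}.Infinite

/-- Length of `π^(m)(1,x)`: the `x`-th smallest (0-indexed) element of
`{k : C(A^(m)[1,k]) ≤ m}`. -/
def piLen (m x : ℕ) : ℕ := Nat.nth (fun k => curl (gPrefix m k) ≤ m) x

/-- `π^(m)(1,x)`: the prefix of `A^(m)` with exactly `x` occurrences of `m`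
and curling number at most `m`. -/
def piStr (m x : ℕ) : List ℕ := gPrefix m (piLen m x)

/-- `β^(m)(t)`, the length of `B_t^(m)`. -/
def beta (m t : ℕ) : ℕ := piLen m ((m + 1) ^ (t - 1))

/-- `B_t^(m) := π^(m)(1,(m+1)^(t-1))`. -/
def Bstr (m t : ℕ) : List ℕ := piStr m ((m + 1) ^ (t - 1))

/-- `τ^(m)(t)`, the length of `T_t^(m)`. -/
def tau (m t : ℕ) : ℕ := Nat.nth (fun k => curl (gPrefix (m + 1) k) ≤ m) (t - 1)

/-- `T_t^(m)`: the `t`-th shortest prefix of `A^(m+1)` with curling number at most `m`. -/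
def Tstr (m t : ℕ) : List ℕ := gPrefix (m + 1) (tau m t)

/-- `φ^(m)(n)`: the least `p ≥ 1` with `A^(m)(p) = n`. -/
def phi (m n : ℕ) : ℕ := sInf {p : ℕ | 1 ≤ p ∧ gij m p = n}

/-- `t^(m)(n) = 1 + log_{m+1} #\{i ≤ φ^(m)(n) : A^(m)(i) = m\}`. -/
def tfun (m n : ℕ) : ℕ := 1 + Nat.log (m + 1) ((gPrefix m (phi m n)).count m)

/-- `χ^(b)(a)`: read the base-`b` digits of `a` as base-`(b+1)` digits. -/
def chi (b a : ℕ) : ℕ := Nat.ofDigits (b + 1) (Nat.digits b a)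

/-- `ι_m(t)`: read the base-`(m+2)` digits of the number of occurrences of `m+1`
in `T_t^(m)` as base-`(m+1)` digits. -/
def iota (m t : ℕ) : ℕ :=
  Nat.ofDigits (m + 1) (Nat.digits (m + 2) ((Tstr m t).count (m + 1)))

/-- `ι_m⁻¹(p)`: the largest `x ≥ 1` with `ι_m(x) ≤ p`. -/
def iotaInv (m p : ℕ) : ℕ := sSup {x : ℕ | 1 ≤ x ∧ iota m x ≤ p}

/-- `ord_b(n)`: the `b`-adic valuation of `n`. -/
def ordb (b n : ℕ) : ℕ := sSup {z : ℕ | b ^ z ∣ n}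

/-- The largest base-`b` digit of `n`. -/
def maxdigit (b n : ℕ) : ℕ := (Nat.digits b n).foldr max 0

/-- Auxiliary function for the level-`m` expansion: `lexpAux m a k = a_{m+1+k}`. -/
def lexpAux (m a : ℕ) : ℕ → ℕ
  | 0 => a
  | k + 1 => iota (m + 1 + k) (ordb (m + 1 + k) (lexpAux m a k) + 1)

/-- `lexp m a l = a_l`, the `l`-th term of the level-`m` expansion of `a`. -/
def lexp (m a l : ℕ) : ℕ := lexpAux m a (l - (m + 1))

/-- The last element `n` of `π^(m+1)(1, χ^(m+1)(a))`; the level-`m` expansion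
of `a` is `a_{m+1}, …, a_n`. -/
def levelEnd (m a : ℕ) : ℕ := (piStr (m + 1) (chi (m + 1) a)).getLastD 0

/-- `V_m := {v ≥ 0 : C(T_{v+1}^(m+1)) ≤ m}`. -/
def Vset (m : ℕ) : Set ℕ := {v | curl (Tstr (m + 1) (v + 1)) ≤ m}

/-- `Q := {α ≥ 0 : C(T_{α+1}^(2)) = 1}`. -/
def Qset : Set ℕ := {a | curl (Tstr 2 (a + 1)) = 1}

/-- `R := {(a,b) : a ∈ Q, a < b, no suffix S of T_{a+1}^(2) with T_{a+1}^(2)·S = T_{b+1}^(2)}`. -/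
def Rset : Set (ℕ × ℕ) :=
  {p | p.1 ∈ Qset ∧ p.1 < p.2 ∧
    ¬∃ S : List ℕ, S <:+ Tstr 2 (p.1 + 1) ∧ Tstr 2 (p.1 + 1) ++ S = Tstr 2 (p.2 + 1)}

/-- The digit of `x` in base `b` at (1-indexed) position `i`, i.e. the coefficient
of `b^(i-1)`. -/
def digitAt (b x i : ℕ) : ℕ := (Nat.digits b x).getD (i - 1) 0

/-- `u` is the (1-indexed) position of the second nonzero base-`b` digit of `x`
(the first nonzero digit being at position `ord_b(x)+1`). -/
def IsSecondNonzero (b x u : ℕ) : Prop :=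
  ordb b x + 1 < u ∧ digitAt b x u ≠ 0 ∧
    ∀ i, ordb b x + 1 < i → i < u → digitAt b x i = 0

/-- `𝒮_b`: pairs `(a,a')` with `1 ≤ a < a'` such that for some position `y` the
base-`b` digits of `a` and `a'` agree away from `y` and twice the `y`-th digit of `a`
is at least the `y`-th digit of `a'`. -/
def Sset (b : ℕ) : Set (ℕ × ℕ) :=
  {p | 1 ≤ p.1 ∧ p.1 < p.2 ∧
    ∃ y : ℕ, (∀ i, i ≠ y → (Nat.digits b p.1).getD i 0 = (Nat.digits b p.2).getD i 0) ∧
      (Nat.digits b p.2).getD y 0 ≤ 2 * (Nat.digits b p.1).getD y 0}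

/-- The glue string `S_t^(m)`, so that `T_{t+1}^(m) = T_t^(m) ++ glue m t`. -/
def glue (m t : ℕ) : List ℕ := (gPrefix (m + 1) (tau m (t + 1))).drop (tau m t)

/-- The strings `P_t^(m)`: `P_1^(m) = (m)` and `P_{t+1}^(m) = P_t^(m)·B_t^(m)·S_t^(m)`. -/
def Pstr (m : ℕ) : ℕ → List ℕ
  | 0 => []
  | 1 => [m]
  | t + 2 => Pstr m (t + 1) ++ Bstr m (t + 1) ++ glue m (t + 1)

end

/-! ### Repetitions at the end of a prefix of a sequence -/

/-- The length-`n` prefix of `F` ends in `k` consecutive copies of a block of length `L`. -/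
def EndsInPower (F : ℕ → ℕ) (n k L : ℕ) : Prop :=
  0 < L ∧ k * L ≤ n ∧ ∀ q, n ≤ q + k * L → q + L < n → F (q + L) = F q

theorem EndsInPower.mono {F : ℕ → ℕ} {n k k' L : ℕ} (h : EndsInPower F n k L) (hk : k' ≤ k) :
    EndsInPower F n k' L := by
  obtain ⟨h1, h2, h3⟩ := h
  have := Nat.mul_le_mul_right L hk
  exact ⟨h1, by omega, fun q hq hq' => h3 q (by omega) hq'⟩

theorem EndsInPower.of_eq_append {F : ℕ → ℕ} {n k : ℕ} {X Y : List ℕ} (hY : Y ≠ [])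
    (h : (List.range n).map F = X ++ (List.replicate k Y).flatten) :
    EndsInPower F n k Y.length := by
  have hlen : n = X.length + k * Y.length := by
    simpa using congrArg List.length h
  refine ⟨List.length_pos_iff.2 hY, by omega, fun q hq hq' => ?_⟩
  obtain _ | k := k
  · simp at hlen; omega
  rw [Nat.add_mul] at hlen hq
  obtain ⟨i, rfl⟩ : ∃ i, q = X.length + i := ⟨q - X.length, by omega⟩
  have get (r : ℕ) (hr : X.length + r < n) :
      some (F (X.length + r)) = (List.replicate (k + 1) Y).flatten[r]? := by
    have := congrArg (fun l => l[X.length + r]?) h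
    simpa [hr, List.getElem?_append_right] using this
  have hi : i < (List.replicate k Y).flatten.length := by simp; omega
  have e1 := get (i + Y.length) (by omega)
  rw [List.replicate_succ, List.flatten_cons, List.getElem?_append_right (by omega),
    Nat.add_sub_cancel] at e1
  have e2 := get i (by omega)
  rw [List.replicate_succ', List.flatten_append, List.getElem?_append_left hi, ← e1] at e2
  rw [add_assoc]
  exact (Option.some.inj e2).symm

theorem EndsInPower.exists_eq_append {F : ℕ → ℕ} {n k L : ℕ} (h : EndsInPower F n k L) :
    ∃ X Y : List ℕ, Y ≠ [] ∧ (List.range n).map F = X ++ (List.replicate k Y).flatten := by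
  obtain ⟨hL, hn, hper⟩ := h
  obtain ⟨s, rfl⟩ : ∃ s, n = s + k * L := ⟨n - k * L, by omega⟩
  refine ⟨(List.range s).map F, (List.range L).map (fun i => F (s + i)), ?_, ?_⟩
  · simpa using hL.ne'
  have shift (c i : ℕ) (hi : i < L) (hc : c < k) : F (s + (c * L + i)) = F (s + i) := by
    induction c with
    | zero => simp
    | succ c ih =>
      have hck := Nat.mul_le_mul_right L (show c + 2 ≤ k by omega)
      rw [← ih (by omega), ← hper (s + (c * L + i)) (by omega) (by nlinarith)]
      congr 1; ring
  have flat (c : ℕ) (hc : c ≤ k) : (List.range (c * L)).map (fun i => F (s + i)) =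
      (List.replicate c ((List.range L).map (fun i => F (s + i)))).flatten := by
    induction c with
    | zero => simp
    | succ c ih =>
      rw [Nat.add_mul, one_mul, List.range_add, List.map_append, ih (by omega),
        List.replicate_succ', List.flatten_append]
      congr 1
      simp only [List.flatten_cons, List.flatten_nil, List.append_nil, List.map_map]
      refine List.map_congr_left fun i hi => ?_
      exact shift c i (List.mem_range.1 hi) (by omega)
  rw [← flat k le_rfl, List.range_add, List.map_append, List.map_map]
  rfl

theorem le_curl_iff {F : ℕ → ℕ} {n k : ℕ} (hk : 2 ≤ k) :
    k ≤ curl ((List.range n).map F) ↔ ∃ L, EndsInPower F n k L := by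
  set s : Set ℕ := {k | ∃ X Y : List ℕ, Y ≠ [] ∧
    (List.range n).map F = X ++ (List.replicate k Y).flatten} with hs
  have hb : BddAbove s := by
    refine ⟨n, ?_⟩
    rintro k ⟨X, Y, hY, h⟩
    obtain ⟨h1, h2, -⟩ := EndsInPower.of_eq_append hY h
    nlinarith
  have hc : curl ((List.range n).map F) = max 1 (sSup s) := rfl
  rw [hc]
  constructor
  · intro h
    have hne : s.Nonempty := ⟨0, (List.range n).map F, [0], by simp, by simp⟩
    obtain ⟨X, Y, hY, h'⟩ := Nat.sSup_mem hne hb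
    exact ⟨_, (EndsInPower.of_eq_append hY h').mono (by omega)⟩
  · rintro ⟨L, h⟩
    exact le_max_of_le_right (le_csSup hb h.exists_eq_append)

theorem curl_range_congr {F F' : ℕ → ℕ} {n : ℕ} (h : ∀ q < n, F q = F' q) :
    curl ((List.range n).map F) = curl ((List.range n).map F') := by
  congr 1
  exact List.map_congr_left fun q hq => h q (List.mem_range.1 hq)

theorem curl_nil : curl [] = 1 := by
  refine le_antisymm (not_lt.1 fun h => ?_) (le_max_left _ _)
  have h2 : 2 ≤ curl ((List.range 0).map id) := h
  obtain ⟨L, h1, h3, -⟩ := (le_curl_iff le_rfl).1 h2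
  omega

/-- The Gijswijt sequence of level `m`, indexed from `0`. -/
noncomputable def gterm (m n : ℕ) : ℕ := max m (curl (gPrefix m n))

theorem gPrefix_eq_map (m n : ℕ) : gPrefix m n = (List.range n).map (gterm m) := by
  induction n with
  | zero => rfl
  | succ n ih =>
    rw [List.range_succ, List.map_append, ← ih]
    rfl

/-! ### Valuations -/

theorem pow_dvd_iff_le_ordb {B X z : ℕ} (hB : 2 ≤ B) (hX : 0 < X) :
    B ^ z ∣ X ↔ z ≤ ordb B X := by
  have hb : BddAbove {z : ℕ | B ^ z ∣ X} :=
    ⟨X, fun z hz => ((Nat.lt_pow_self hB).le).trans (Nat.le_of_dvd hX hz)⟩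
  refine ⟨fun h => le_csSup hb h, fun h => ?_⟩
  have := Nat.sSup_mem (s := {z : ℕ | B ^ z ∣ X}) ⟨0, by simp⟩ hb
  exact (pow_dvd_pow B h).trans this

theorem ordb_eq_of_dvd_iff {B X Y : ℕ} (h : ∀ z, B ^ z ∣ X ↔ B ^ z ∣ Y) :
    ordb B X = ordb B Y := by
  simp only [ordb, h]

theorem ordb_add_eq {B e j y : ℕ} (hj : B ^ e ∣ j) (h1 : ¬ B ^ (e + 1) ∣ y)
    (h2 : ¬ B ^ (e + 1) ∣ y + j) : ordb B (y + j) = ordb B y := by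
  refine ordb_eq_of_dvd_iff fun z => ?_
  rcases le_or_gt z e with hz | hz
  · exact (Nat.dvd_add_iff_left ((pow_dvd_pow B hz).trans hj)).symm
  · exact iff_of_false (fun h => h2 ((pow_dvd_pow B hz).trans h))
      (fun h => h1 ((pow_dvd_pow B hz).trans h))

/-- If `ordb B` has period `j` on the `k * j - 1` integers below `X`, then `j` is at least
a power `B ^ e` such that none of these integers is divisible by `B ^ (e + 1)`. -/
theorem exists_pow_of_ordb_periodic {B X j k : ℕ} (hB : 2 ≤ B) (hj : 0 < j) (hk : 3 ≤ k)
    (hX : k * j ≤ X)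
    (hper : ∀ y, X < y + k * j → y + j < X → ordb B (y + j) = ordb B y) :
    ∃ e, B ^ e ≤ j ∧ ∀ y, X < y + k * j → y < X → ¬ B ^ (e + 1) ∣ y := by
  have h3 : 3 * j ≤ k * j := Nat.mul_le_mul_right j hk
  set e := Nat.log B j
  have he : B ^ e ≤ j := Nat.pow_log_le_self B hj.ne'
  have he' : j < B ^ (e + 1) := Nat.lt_pow_succ_log_self hB j
  refine ⟨e, he, ?_⟩
  obtain ⟨z, hz, hmax⟩ := (Finset.Ico (X - j) X).exists_max_image (ordb B)
    ⟨X - j, by simp; omega⟩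
  rw [Finset.mem_Ico] at hz
  have hze : ordb B z ≤ e := by
    have h1 := hper (z - j) (by omega) (by omega)
    rw [Nat.sub_add_cancel (by omega)] at h1
    have d1 := (pow_dvd_iff_le_ordb hB (by omega)).2 (le_refl (ordb B z))
    have d2 := (pow_dvd_iff_le_ordb hB (show 0 < z - j by omega)).2 h1.le
    have d3 : B ^ ordb B z ∣ j := by
      have := Nat.dvd_sub d1 d2
      rwa [show z - (z - j) = j by omega] at this
    have := Nat.le_of_dvd hj d3
    by_contra hlt
    exact absurd (Nat.pow_le_pow_right (by omega : 0 < B) (not_le.1 hlt)) (by simp; omega)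
  have key (d : ℕ) : ∀ y, X = y + d → X < y + k * j → y < X → ordb B y ≤ e := by
    induction d using Nat.strong_induction_on with
    | _ d ih =>
      intro y hd hy hyX
      rcases le_or_gt X (y + j) with h | h
      · exact (hmax y (by simp; omega)).trans hze
      · rw [← hper y hy h]
        exact ih (d - j) (by omega) _ (by omega) (by omega) h
  intro y hy hyX hdvd
  have := key (X - y) y (by omega) hy hyX
  have := (pow_dvd_iff_le_ordb hB (show 0 < y by omega)).1 hdvd
  omega

theorem exists_dvd_near {D : ℕ} (X : ℕ) (hD : 0 < D) : ∃ y, X < y + D ∧ y ≤ X ∧ D ∣ y :=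
  ⟨D * (X / D), by have := Nat.div_add_mod X D; have := Nat.mod_lt X hD; omega,
    Nat.mul_div_le X D, Nat.dvd_mul_right _ _⟩

theorem le_base_of_ordb_periodic {B X j k : ℕ} (hB : 2 ≤ B) (hj : 0 < j) (hk : 3 ≤ k)
    (hX : k * j ≤ X)
    (hper : ∀ y, X < y + k * j → y + j < X → ordb B (y + j) = ordb B y) : k ≤ B := by
  obtain ⟨e, he, hno⟩ := exists_pow_of_ordb_periodic hB hj hk hX hper
  by_contra hlt
  have h1 : (B + 1) * j ≤ k * j := Nat.mul_le_mul_right j (by omega)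
  have h2 : B ^ (e + 1) ≤ B * j := by rw [pow_succ']; exact Nat.mul_le_mul_left B he
  have h3 : (B + 1) * j = B * j + j := by ring
  obtain ⟨y, hy1, hy2, hy3⟩ := exists_dvd_near (D := B ^ (e + 1)) (X - 1) (by positivity)
  exact hno y (by omega) (by omega) hy3

theorem exists_le_digit_of_ordb_periodic {B X j k : ℕ} (hB : 2 ≤ B) (hj : 0 < j) (hk : 3 ≤ k)
    (hX : k * j ≤ X)
    (hper : ∀ y, X < y + k * j → y + j < X → ordb B (y + j) = ordb B y)
    (hle : ordb B X ≤ ordb B (X - j)) : ∃ e, k ≤ X / B ^ e % B := by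
  obtain ⟨e, he, hno⟩ := exists_pow_of_ordb_periodic hB hj hk hX hper
  have h3 : 3 * j ≤ k * j := Nat.mul_le_mul_right j hk
  have hXd : ¬ B ^ (e + 1) ∣ X := fun h =>
    hno (X - j) (by omega) (by omega) <| (pow_dvd_iff_le_ordb hB (by omega)).2 <|
      ((pow_dvd_iff_le_ordb hB (by omega)).1 h).trans hle
  refine ⟨e, ?_⟩
  have hmod : k * j ≤ X % B ^ (e + 1) := by
    have h1 := Nat.div_add_mod X (B ^ (e + 1))
    by_contra hlt
    rcases eq_or_ne (X % B ^ (e + 1)) 0 with h0 | h0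
    · exact hXd (Nat.dvd_of_mod_eq_zero h0)
    · exact hno (B ^ (e + 1) * (X / B ^ (e + 1))) (by omega) (by omega) (Nat.dvd_mul_right _ _)
  rw [← Nat.mod_mul_right_div_self, ← pow_succ, Nat.le_div_iff_mul_le (by positivity)]
  exact (Nat.mul_le_mul_left k he).trans hmod

/-! ### Block sequences -/

theorem count_shift {P : ℕ → Prop} [DecidablePred P] {s n L : ℕ}
    (h : ∀ q, s ≤ q → q + L < n → (P (q + L) ↔ P q)) {q : ℕ} (hq : s ≤ q) (hqn : q + L ≤ n) :
    Nat.count P (q + L) + Nat.count P s = Nat.count P q + Nat.count P (s + L) := by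
  induction q, hq using Nat.le_induction with
  | base => ring
  | succ q hq ih =>
    have := ih (by omega)
    rw [show q + 1 + L = q + L + 1 by ring, Nat.count_succ, Nat.count_succ]
    simp only [h q hq (by omega)]
    omega

/-- The position (from `0`) of the `x`-th letter `b` in the sequence
`b W₁ b W₂ b W₃ …` in which `W_y` has length `N (ordb (b + 1) y)`. -/
noncomputable def blockPos (b : ℕ) (N : ℕ → ℕ) : ℕ → ℕ
  | 0 => 0
  | x + 1 => blockPos b N x + 1 + N (ordb (b + 1) (x + 1))

/-- `G = b W₁ b W₂ b W₃ …`, where `W_y` is the prefix of `h` of length `N (ordb (b + 1) y)`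
and the letters of `h` exceed `b`. -/
structure IsBlockSeq (b : ℕ) (N h G : ℕ → ℕ) : Prop where
  strictMono : StrictMono N
  lt_letter : ∀ n, b < h n
  at_pos : ∀ x, G (blockPos b N x) = b
  inner : ∀ x r, r < N (ordb (b + 1) (x + 1)) → G (blockPos b N x + 1 + r) = h r

section Block

variable {b : ℕ} {N h G : ℕ → ℕ}

theorem blockPos_strictMono (b : ℕ) (N : ℕ → ℕ) : StrictMono (blockPos b N) :=
  strictMono_nat_of_lt_succ fun x => by simp only [blockPos]; omega

theorem exists_blockPos_le (b : ℕ) (N : ℕ → ℕ) (n : ℕ) :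
    ∃ x, blockPos b N x ≤ n ∧ n < blockPos b N (x + 1) := by
  induction n with
  | zero => exact ⟨0, le_rfl, blockPos_strictMono b N (Nat.lt_succ_self 0)⟩
  | succ n ih =>
    obtain ⟨x, h1, h2⟩ := ih
    rcases lt_or_ge (n + 1) (blockPos b N (x + 1)) with h | h
    · exact ⟨x, by omega, h⟩
    · exact ⟨x + 1, h, (Nat.succ_le_of_lt h2).trans_lt
        (blockPos_strictMono b N (Nat.lt_succ_self (x + 1)))⟩

theorem exists_isBlockSeq (hN : StrictMono N) (hh : ∀ n, b < h n) : ∃ G, IsBlockSeq b N h G := by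
  choose f hf1 hf2 using exists_blockPos_le b N
  have hf (x n : ℕ) (h1 : blockPos b N x ≤ n) (h2 : n < blockPos b N (x + 1)) : f n = x := by
    have h3 := (blockPos_strictMono b N).lt_iff_lt.1 ((hf1 n).trans_lt h2)
    have h4 := (blockPos_strictMono b N).lt_iff_lt.1 (h1.trans_lt (hf2 n))
    omega
  refine ⟨fun n => if n = blockPos b N (f n) then b else h (n - blockPos b N (f n) - 1),
    hN, hh, fun x => ?_, fun x r hr => ?_⟩
  · rw [hf x _ le_rfl (blockPos_strictMono b N (Nat.lt_succ_self x)), if_pos rfl]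
  · have : f (blockPos b N x + 1 + r) = x := hf x _ (by omega) (by simp only [blockPos]; omega)
    simp only [this]
    rw [if_neg (by omega)]
    congr 1
    omega

namespace IsBlockSeq

theorem eq_iff (H : IsBlockSeq b N h G) {n : ℕ} : G n = b ↔ n ∈ Set.range (blockPos b N) := by
  refine ⟨fun hn => ?_, ?_⟩
  · obtain ⟨x, h1, h2⟩ := exists_blockPos_le b N n
    rcases eq_or_lt_of_le h1 with h3 | h3
    · exact ⟨x, h3⟩
    · obtain ⟨r, rfl⟩ : ∃ r, n = blockPos b N x + 1 + r := ⟨n - blockPos b N x - 1, by omega⟩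
      have := H.inner x r (by simp only [blockPos] at h2; omega)
      have := H.lt_letter r
      omega
  · rintro ⟨x, rfl⟩
    exact H.at_pos x

theorem infinite (H : IsBlockSeq b N h G) : (Set.ofPred fun n => G n = b).Infinite := by
  have : (Set.ofPred fun n => G n = b) = Set.range (blockPos b N) := by
    ext n
    exact H.eq_iff
  rw [this]
  exact Set.infinite_range_of_injective (blockPos_strictMono b N).injective

theorem nth_eq (H : IsBlockSeq b N h G) : Nat.nth (fun n => G n = b) = blockPos b N := by
  refine ((Nat.nth_strictMono H.infinite).range_inj (blockPos_strictMono b N)).1 ?_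
  rw [Nat.range_nth_of_infinite H.infinite]
  ext n
  exact H.eq_iff

theorem endsInPower_iff (H : IsBlockSeq b N h G) {x r k L : ℕ} (hr : r ≤ N (ordb (b + 1) (x + 1)))
    (hk : k * L ≤ r) :
    EndsInPower G (blockPos b N x + 1 + r) k L ↔ EndsInPower h r k L := by
  constructor
  · rintro ⟨h1, -, h3⟩
    refine ⟨h1, hk, fun q hq hq' => ?_⟩
    rw [← H.inner x q (by omega), ← H.inner x (q + L) (by omega), ← add_assoc]
    exact h3 _ (by omega) (by omega)
  · rintro ⟨h1, -, h3⟩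
    refine ⟨h1, by omega, fun q hq hq' => ?_⟩
    obtain ⟨i, rfl⟩ : ∃ i, q = blockPos b N x + 1 + i := ⟨q - blockPos b N x - 1, by omega⟩
    rw [H.inner x i (by omega), add_assoc (blockPos b N x + 1), H.inner x _ (by omega)]
    exact h3 i (by omega) (by omega)

/-- A repetition at the end of a block sequence either lies inside the last block or forces
the block lengths to be periodic. -/
theorem periodic (H : IsBlockSeq b N h G) {x r k L : ℕ} (hr : r ≤ N (ordb (b + 1) (x + 1)))
    (hk : 2 ≤ k)
    (hG : EndsInPower G (blockPos b N x + 1 + r) k L) :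
    EndsInPower h r k L ∨ ∃ j, 0 < j ∧ k * j ≤ x + 1 ∧
      (∀ y, x + 1 < y + k * j → y + j < x + 1 →
        ordb (b + 1) (y + j) = ordb (b + 1) y) ∧ r ≤ N (ordb (b + 1) (x + 1 - j)) := by
  obtain ⟨hL, hkL, hper⟩ := id hG
  set p := blockPos b N with hp
  set P : ℕ → Prop := fun n => G n = b with hP
  have hnth : Nat.nth P = p := H.nth_eq
  have hinf : (Set.ofPred P).Infinite := H.infinite
  set n := p x + 1 + r with hn
  have h2L : 2 * L ≤ k * L := Nat.mul_le_mul_right L hk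
  have hcn : Nat.count P n = x + 1 := by
    refine le_antisymm ?_ ?_
    · rw [Nat.count_le_iff_le_nth hinf, hnth]
      simp only [hp, blockPos] at hn ⊢
      omega
    · have : Nat.count P (p x + 1) = x + 1 := by
        rw [← hnth, Nat.count_nth_succ_of_infinite hinf]
      rw [← this]
      exact Nat.count_monotone P (by omega)
  obtain ⟨s, hs⟩ : ∃ s, n = s + k * L := ⟨n - k * L, by omega⟩
  obtain ⟨j, hj⟩ : ∃ j, Nat.count P (s + L) = Nat.count P s + j :=
    ⟨_, (Nat.add_sub_of_le (Nat.count_monotone P (by omega))).symm⟩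
  have shift {q : ℕ} (hq : s ≤ q) (hqn : q + L ≤ n) :
      Nat.count P (q + L) = Nat.count P q + j := by
    have := count_shift (P := P) (s := s) (n := n) (L := L)
      (fun q h1 h2 => by simp only [hP, hper q (by omega) h2]) hq hqn
    omega
  have mult (i : ℕ) (hi : i ≤ k) : Nat.count P (s + i * L) = Nat.count P s + i * j := by
    induction i with
    | zero => simp
    | succ i ih =>
      have h1 := Nat.mul_le_mul_right L hi
      rw [Nat.add_mul, one_mul] at h1
      rw [Nat.add_mul, one_mul, ← add_assoc, shift (by omega) (by omega), ih (by omega)]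
      ring
  have hX : Nat.count P s + k * j = x + 1 := by rw [← mult k le_rfl, ← hs, hcn]
  rcases Nat.eq_zero_or_pos j with rfl | hj0
  · left
    have : p x < s := by
      rw [← hnth]
      exact Nat.nth_lt_of_lt_count (by omega)
    exact (H.endsInPower_iff hr (by omega)).1 hG
  · right
    have h2j : 2 * j ≤ k * j := Nat.mul_le_mul_right j hk
    have pos (z : ℕ) (hz : Nat.count P s ≤ z) (hz' : z + j < x + 1) : p (z + j) = p z + L := by
      have h1 : s + L ≤ p (z + j) := by
        rw [← hnth, ← Nat.count_le_iff_le_nth hinf]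
        omega
      have h2 : p (z + j) < n := by
        rw [← hnth]
        exact Nat.nth_lt_of_lt_count (by omega)
      have h3 : P (p (z + j) - L) := by
        have := hper (p (z + j) - L) (by omega) (by omega)
        rw [Nat.sub_add_cancel (by omega)] at this
        exact this.symm.trans (H.at_pos _)
      have h4 := shift (q := p (z + j) - L) (by omega) (by omega)
      rw [Nat.sub_add_cancel (by omega), ← hnth, Nat.count_nth_of_infinite hinf, hnth] at h4
      have h5 := Nat.nth_count h3
      rw [← Nat.add_right_cancel h4, hnth] at h5
      omega
    refine ⟨j, hj0, by omega, fun y hy hy' => ?_, ?_⟩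
    · obtain ⟨z, rfl⟩ : ∃ z, y = z + 1 := ⟨y - 1, by omega⟩
      have e1 := pos z (by omega) (by omega)
      have e2 := pos (z + 1) (by omega) (by omega)
      rw [show z + 1 + j = z + j + 1 by ring] at e2 ⊢
      simp only [hp, blockPos] at e1 e2
      exact H.strictMono.injective (by omega)
    · have e1 := pos (x - j) (by omega) (by omega)
      rw [Nat.sub_add_cancel (by omega)] at e1
      have e2 := shift (q := n - L) (by omega) (by omega)
      rw [Nat.sub_add_cancel (by omega), hcn] at e2
      have e3 : n - L ≤ p (x - j + 1) := by
        rw [← hnth, ← Nat.count_le_iff_le_nth hinf]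
        omega
      rw [show x + 1 - j = x - j + 1 by omega]
      have e4 : p (x - j + 1) = p (x - j) + 1 + N (ordb (b + 1) (x - j + 1)) := rfl
      omega

theorem exists_endsInPower (H : IsBlockSeq b N h G) {x r k j Z : ℕ} (hk : 0 < k) (hj : 0 < j)
    (hx : x + 1 = Z + (k + 1) * j)
    (hper : ∀ y, Z < y → y + j < x + 1 → ordb (b + 1) (y + j) = ordb (b + 1) y)
    (hr : r = N (ordb (b + 1) (Z + k * j))) (hle : r ≤ N (ordb (b + 1) (x + 1))) :
    ∃ L, EndsInPower G (blockPos b N x + 1 + r) (k + 1) L := by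
  set p := blockPos b N with hp
  have hmono : StrictMono p := blockPos_strictMono b N
  obtain ⟨L, hL⟩ : ∃ L, p (Z + j) = p Z + L :=
    ⟨_, (Nat.add_sub_of_le (hmono.monotone (by omega))).symm⟩
  have hL0 : 0 < L := by
    have := hmono (show Z < Z + j by omega)
    omega
  rw [Nat.add_mul, one_mul] at hx
  have hkj : 0 < k * j := Nat.mul_pos hk hj
  have pos (i : ℕ) (hi : i < k * j) : p (Z + i + j) = p (Z + i) + L := by
    induction i with
    | zero => exact hL
    | succ i ih =>
      have e1 := ih (by omega)
      have e2 := hper (Z + i + 1) (by omega) (by omega)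
      rw [show Z + i + 1 + j = Z + i + j + 1 by ring] at e2
      rw [show Z + (i + 1) + j = Z + i + j + 1 by ring, ← add_assoc]
      simp only [hp, blockPos] at e1 ⊢
      rw [e2]
      omega
  have mult (i : ℕ) (hi : i ≤ k) : p (Z + i * j) = p Z + i * L := by
    induction i with
    | zero => simp
    | succ i ih =>
      have h1 := Nat.mul_le_mul_right j hi
      rw [Nat.add_mul, one_mul] at h1
      rw [Nat.add_mul, one_mul, ← add_assoc, pos _ (by omega), ih (by omega)]
      ring
  have hn : p x + 1 + r = p (Z + k * j) + L := by
    have e1 := pos (k * j - 1) (by omega)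
    rw [show Z + (k * j - 1) + j = x by omega] at e1
    have e2 : p (Z + (k * j - 1) + 1) =
      p (Z + (k * j - 1)) + 1 + N (ordb (b + 1) (Z + (k * j - 1) + 1)) := rfl
    rw [show Z + (k * j - 1) + 1 = Z + k * j by omega, ← hr] at e2
    omega
  have hn' : p x + 1 + r = p Z + (k + 1) * L := by
    rw [hn, mult k le_rfl]
    ring
  refine ⟨L, hL0, by omega, fun q hq hq' => ?_⟩
  obtain ⟨z, h1, h2⟩ : ∃ z, p z ≤ q ∧ q < p (z + 1) := exists_blockPos_le b N q
  have hz1 : Z ≤ z := Nat.lt_succ_iff.1 (hmono.lt_iff_lt.1 (show p Z < p (z + 1) by omega))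
  have hz2 : z < Z + k * j := hmono.lt_iff_lt.1 (show p z < p (Z + k * j) by omega)
  have e1 := pos (z - Z) (by omega)
  rw [Nat.add_sub_of_le hz1] at e1
  rcases eq_or_lt_of_le h1 with h3 | h3
  · rw [← h3, ← e1, H.at_pos, H.at_pos]
  · obtain ⟨i, rfl⟩ : ∃ i, q = p z + 1 + i := ⟨q - p z - 1, by omega⟩
    have hi : i < N (ordb (b + 1) (z + 1)) := by
      have : p (z + 1) = p z + 1 + N (ordb (b + 1) (z + 1)) := rfl
      omega
    rw [H.inner z i hi, show p z + 1 + i + L = p (z + j) + 1 + i by omega,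
      H.inner (z + j) i]
    rcases lt_or_ge (z + 1) (Z + k * j) with h4 | h4
    · rwa [show z + j + 1 = z + 1 + j by ring, hper (z + 1) (by omega) (by omega)]
    · rw [show z + 1 = Z + k * j by omega, ← hr] at hi
      rw [show z + j + 1 = x + 1 by omega]
      omega

theorem exists_endsInPower_of_lt_ordb (H : IsBlockSeq b N h G) {x e : ℕ} (hb : 1 ≤ b)
    (he : e < ordb (b + 1) (x + 1)) :
    ∃ L, EndsInPower G (blockPos b N x + 1 + N e) (b + 1) L := by
  have hB : 2 ≤ b + 1 := by omega
  have hdvd : (b + 1) ^ (e + 1) ∣ x + 1 := (pow_dvd_iff_le_ordb hB (by omega)).2 he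
  have hle := Nat.le_of_dvd (by omega) hdvd
  have hpow : (b + 1) ^ (e + 1) = b * (b + 1) ^ e + (b + 1) ^ e := by ring
  have hj : 0 < (b + 1) ^ e := by positivity
  have hbj : 0 < b * (b + 1) ^ e := Nat.mul_pos hb hj
  have hno (y : ℕ) (h1 : x + 1 < y + (b + 1) ^ (e + 1)) (h2 : y < x + 1) :
      ¬ (b + 1) ^ (e + 1) ∣ y := fun h3 => by
    have := Nat.le_of_dvd (by omega) (Nat.dvd_sub hdvd h3)
    omega
  refine H.exists_endsInPower (j := (b + 1) ^ e) (Z := x + 1 - (b + 1) ^ (e + 1)) hb hj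
    (by rw [Nat.add_mul, one_mul]; omega) (fun y h1 h2 => ?_) ?_
    (H.strictMono.monotone he.le)
  · exact ordb_add_eq dvd_rfl (hno y (by omega) (by omega)) (hno _ (by omega) h2)
  · have h0 : x + 1 - (b + 1) ^ (e + 1) + b * (b + 1) ^ e = x + 1 - (b + 1) ^ e := by omega
    rw [h0]
    congr 1
    refine le_antisymm ?_ ?_
    · rw [← pow_dvd_iff_le_ordb hB (by omega)]
      exact Nat.dvd_sub ((pow_dvd_pow _ (Nat.le_succ e)).trans hdvd) dvd_rfl
    · by_contra hlt
      exact hno _ (by omega) (by omega) ((pow_dvd_iff_le_ordb hB (by omega)).2 (not_le.1 hlt))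

theorem exists_endsInPower_of_digit (H : IsBlockSeq b N h G) {X d e : ℕ} (hb : 1 ≤ b) (hd : 2 ≤ d)
    (hX : X / (b + 1) ^ e % (b + 1) = d) : ∃ L, EndsInPower G (blockPos b N X) d L := by
  obtain ⟨x, rfl⟩ : ∃ x, X = x + 1 := by
    rcases X with _ | x
    · simp at hX; omega
    · exact ⟨x, rfl⟩
  obtain ⟨k, rfl⟩ : ∃ k, d = k + 1 := ⟨d - 1, by omega⟩
  have hj : 0 < (b + 1) ^ e := by positivity
  rw [← Nat.mod_mul_right_div_self, ← pow_succ] at hX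
  have hmod : (k + 1) * (b + 1) ^ e ≤ (x + 1) % (b + 1) ^ (e + 1) :=
    (Nat.le_div_iff_mul_le hj).1 hX.ge
  have hle := hmod.trans (Nat.mod_le _ _)
  have hkj : 0 < k * (b + 1) ^ e := Nat.mul_pos (by omega) hj
  have hkk : (k + 1) * (b + 1) ^ e = k * (b + 1) ^ e + (b + 1) ^ e := by ring
  have hno (y : ℕ) (h1 : x + 1 < y + (k + 1) * (b + 1) ^ e) (h2 : y ≤ x + 1) :
      ¬ (b + 1) ^ (e + 1) ∣ y := fun ⟨c, hc⟩ => by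
    have h3 : (x + 1) % (b + 1) ^ (e + 1) = (x + 1 - y) % (b + 1) ^ (e + 1) := by
      rw [hc, Nat.sub_mul_mod]
      omega
    have := Nat.mod_le (x + 1 - y) ((b + 1) ^ (e + 1))
    omega
  have hper (y : ℕ) (h1 : x + 1 < y + (k + 1) * (b + 1) ^ e) (h2 : y + (b + 1) ^ e ≤ x + 1) :
      ordb (b + 1) (y + (b + 1) ^ e) = ordb (b + 1) y :=
    ordb_add_eq dvd_rfl (hno y h1 (by omega)) (hno _ (by omega) h2)
  have hlast := hper (x + 1 - (b + 1) ^ e) (by omega) (by omega)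
  rw [Nat.sub_add_cancel (by omega)] at hlast
  exact H.exists_endsInPower (j := (b + 1) ^ e) (Z := x + 1 - (k + 1) * (b + 1) ^ e) (by omega) hj
    (by omega) (fun y h1 h2 => hper y (by omega) h2.le)
    (by rw [show x + 1 - (k + 1) * (b + 1) ^ e + k * (b + 1) ^ e = x + 1 - (b + 1) ^ e by omega,
      hlast]) le_rfl

theorem le_curl_of_inner (H : IsBlockSeq b N h G) {x r k : ℕ} (hk : 2 ≤ k)
    (hr : r ≤ N (ordb (b + 1) (x + 1)))
    (hc : k ≤ curl ((List.range r).map h)) :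
    k ≤ curl ((List.range (blockPos b N x + 1 + r)).map G) := by
  obtain ⟨L, hL⟩ := (le_curl_iff hk).1 hc
  exact (le_curl_iff hk).2 ⟨L, (H.endsInPower_iff hr hL.2.1).2 hL⟩

theorem le_curl_of_le_digit (H : IsBlockSeq b N h G) {X k e : ℕ} (hb : 1 ≤ b) (hk : 2 ≤ k)
    (hX : k ≤ X / (b + 1) ^ e % (b + 1)) :
    k ≤ curl ((List.range (blockPos b N X)).map G) := by
  obtain ⟨L, hL⟩ := H.exists_endsInPower_of_digit hb (hk.trans hX) rfl
  exact (le_curl_iff hk).2 ⟨L, hL.mono hX⟩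

theorem inner_or_digit_of_le_curl (H : IsBlockSeq b N h G) {x r k : ℕ} (hb : 1 ≤ b) (hk : 3 ≤ k)
    (hr : r ≤ N (ordb (b + 1) (x + 1)))
    (hc : k ≤ curl ((List.range (blockPos b N x + 1 + r)).map G)) :
    k ≤ curl ((List.range r).map h) ∨ k ≤ b + 1 ∧ (r = N (ordb (b + 1) (x + 1)) →
      ∃ e, k ≤ (x + 1) / (b + 1) ^ e % (b + 1)) := by
  obtain ⟨L, hL⟩ := (le_curl_iff (by omega)).1 hc
  rcases H.periodic hr (by omega) hL with hh | ⟨j, hj, hkj, hper, hle⟩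
  · exact Or.inl ((le_curl_iff (by omega)).2 ⟨L, hh⟩)
  · refine Or.inr ⟨le_base_of_ordb_periodic (by omega) hj hk hkj hper, ?_⟩
    rintro rfl
    exact exists_le_digit_of_ordb_periodic (by omega) hj hk hkj hper
      (H.strictMono.le_iff_le.1 hle)

end IsBlockSeq

end Block

/-! ### The structure of the Gijswijt sequences -/

/-- The length of the `e`-th prefix (from `0`) of `A^(b+1)` with curling number at most `b`. -/
noncomputable def glueLen (b : ℕ) : ℕ → ℕ := Nat.nth fun k => curl (gPrefix (b + 1) k) ≤ b

theorem le_gterm (m n : ℕ) : m ≤ gterm m n := le_max_left _ _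

theorem gterm_eq_iff {m n : ℕ} : gterm m n = m ↔ curl (gPrefix m n) ≤ m := max_eq_left_iff

theorem isBlockSeq_gterm {b : ℕ} (hb : 2 ≤ b)
    (hinf : {k : ℕ | curl (gPrefix (b + 1) k) ≤ b}.Infinite) :
    IsBlockSeq b (glueLen b) (gterm (b + 1)) (gterm b) := by
  have hmono : StrictMono (glueLen b) := Nat.nth_strictMono hinf
  obtain ⟨G, H⟩ := exists_isBlockSeq hmono (fun n => le_gterm (b + 1) n)
  suffices hG : gterm b = G by rwa [hG]
  have hgl (e : ℕ) : curl (gPrefix (b + 1) (glueLen b e)) ≤ b := Nat.nth_mem_of_infinite hinf e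
  funext n
  induction n using Nat.strong_induction_on with
  | _ n ih =>
  have hn : gterm b n = max b (curl ((List.range n).map G)) := by
    rw [gterm, gPrefix_eq_map, curl_range_congr ih]
  obtain ⟨x, h1, h2⟩ := exists_blockPos_le b (glueLen b) n
  rw [hn]
  rcases eq_or_lt_of_le h1 with rfl | h3
  · rw [H.at_pos, max_eq_left_iff]
    rcases x with _ | x
    · simp only [blockPos, List.range_zero, List.map_nil, curl_nil]
      omega
    · by_contra hlt
      rcases H.inner_or_digit_of_le_curl (by omega) (show 3 ≤ b + 1 by omega) le_rfl
        (not_le.1 hlt) with hc | ⟨-, hc⟩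
      · rw [← gPrefix_eq_map] at hc
        exact (hgl _).not_gt hc
      · obtain ⟨e, he⟩ := hc rfl
        exact (Nat.mod_lt ((x + 1) / (b + 1) ^ e) (Nat.succ_pos b)).not_ge he
  · obtain ⟨r, rfl⟩ : ∃ r, n = blockPos b (glueLen b) x + 1 + r :=
      ⟨n - blockPos b (glueLen b) x - 1, by omega⟩
    have hr : r < glueLen b (ordb (b + 1) (x + 1)) := by simp only [blockPos] at h2; omega
    rw [H.inner x r hr, gterm]
    have hpre := gPrefix_eq_map (b + 1) r
    refine le_antisymm (max_le (le_max_of_le_left (Nat.le_succ b)) ?_) (max_le ?_ ?_)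
    · by_contra hlt
      rw [not_le, max_lt_iff] at hlt
      rcases H.inner_or_digit_of_le_curl (by omega) (by omega) hr.le le_rfl with hc | ⟨hc, -⟩
      · rw [← hpre] at hc
        omega
      · omega
    · refine le_max_of_le_right ?_
      rcases lt_or_ge b (curl (gPrefix (b + 1) r)) with hc | hc
      · exact H.le_curl_of_inner (by omega) hr.le (hpre ▸ hc)
      · obtain ⟨e, rfl⟩ : ∃ e, glueLen b e = r := by
          have : r ∈ Set.range (glueLen b) := by
            rw [glueLen, Nat.range_nth_of_infinite hinf]
            exact hc
          exact this
        exact (le_curl_iff (by omega)).2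
          (H.exists_endsInPower_of_lt_ordb (by omega) (hmono.lt_iff_lt.1 hr))
    · rcases lt_or_ge b (curl (gPrefix (b + 1) r)) with hc | hc
      · exact le_max_of_le_right
          (H.le_curl_of_inner (by omega) hr.le (congrArg curl hpre).le)
      · exact le_max_of_le_left hc

theorem StandingHyp.isBlockSeq (hSH : StandingHyp) {b : ℕ} (hb : 2 ≤ b) :
    IsBlockSeq b (glueLen b) (gterm (b + 1)) (gterm b) :=
  isBlockSeq_gterm hb (hSH b (by omega)).2

theorem StandingHyp.piLen_eq (hSH : StandingHyp) {b : ℕ} (hb : 2 ≤ b) :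
    piLen b = blockPos b (glueLen b) := by
  rw [← (hSH.isBlockSeq hb).nth_eq]
  funext x
  simp only [piLen, gterm_eq_iff]

theorem StandingHyp.piStr_eq (hSH : StandingHyp) {b : ℕ} (hb : 2 ≤ b) (X : ℕ) :
    piStr b X = (List.range (blockPos b (glueLen b) X)).map (gterm b) := by
  rw [piStr, hSH.piLen_eq hb, gPrefix_eq_map]

/-! ### Digits -/

theorem le_maxdigit_iff {B X k : ℕ} (hB : 2 ≤ B) :
    k ≤ maxdigit B X ↔ ∃ e, k ≤ X / B ^ e % B := by
  have key (l : List ℕ) : k ≤ l.foldr max 0 ↔ ∃ e, k ≤ l.getD e 0 := by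
    induction l with
    | nil => simp
    | cons d l ih =>
      rw [List.foldr_cons, le_max_iff, ih]
      constructor
      · rintro (h | ⟨e, h⟩)
        · exact ⟨0, by simpa using h⟩
        · exact ⟨e + 1, by simpa using h⟩
      · rintro ⟨_ | e, h⟩
        · exact Or.inl (by simpa using h)
        · exact Or.inr ⟨e, by simpa using h⟩
  simp only [maxdigit, key, Nat.getD_digits _ _ hB]

theorem digits_chi {b : ℕ} (hb : 2 ≤ b) (a : ℕ) : Nat.digits (b + 1) (chi b a) = Nat.digits b a :=
  Nat.digits_ofDigits _ (by omega) _
    (fun _ hd => (Nat.digits_lt_base hb hd).trans (Nat.lt_succ_self b))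
    fun hne => Nat.getLast_digit_ne_zero b (Nat.digits_ne_nil_iff_ne_zero.1 hne)

theorem maxdigit_chi {b : ℕ} (hb : 2 ≤ b) (a : ℕ) : maxdigit (b + 1) (chi b a) = maxdigit b a := by
  rw [maxdigit, digits_chi hb, maxdigit]

theorem chi_pos {b a : ℕ} (hb : 2 ≤ b) (ha : 1 ≤ a) : 1 ≤ chi b a := by
  rw [Nat.one_le_iff_ne_zero, ← Nat.digits_ne_nil_iff_ne_zero (b := b + 1), digits_chi hb,
    Nat.digits_ne_nil_iff_ne_zero]
  omega

theorem chi_eq_mod_add {b : ℕ} (hb : 2 ≤ b) (a : ℕ) :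
    chi b a = a % b + (b + 1) * chi b (a / b) := by
  rcases Nat.eq_zero_or_pos a with rfl | ha
  · simp [chi]
  · rw [chi, Nat.digits_def' hb ha, Nat.ofDigits_cons]
    rfl

theorem pow_succ_dvd_add_mul_iff {B r c z : ℕ} (hr : r < B) :
    B ^ (z + 1) ∣ r + B * c ↔ r = 0 ∧ B ^ z ∣ c := by
  rw [pow_succ']
  constructor
  · intro h
    have h1 : B ∣ r := (Nat.dvd_add_iff_left (Nat.dvd_mul_right B c)).2
      ((Nat.dvd_mul_right _ _).trans h)
    obtain rfl := Nat.eq_zero_of_dvd_of_lt h1 hr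
    rw [zero_add] at h
    exact ⟨rfl, Nat.dvd_of_mul_dvd_mul_left hr h⟩
  · rintro ⟨rfl, h⟩
    rw [zero_add]
    exact Nat.mul_dvd_mul_left B h

theorem pow_dvd_chi_iff {b : ℕ} (hb : 2 ≤ b) (a z : ℕ) : (b + 1) ^ z ∣ chi b a ↔ b ^ z ∣ a := by
  induction z generalizing a with
  | zero => simp
  | succ z ih =>
    have hlt := Nat.mod_lt a (show 0 < b by omega)
    conv_rhs => rw [← Nat.mod_add_div a b]
    rw [chi_eq_mod_add hb, pow_succ_dvd_add_mul_iff (by omega), pow_succ_dvd_add_mul_iff hlt, ih]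

theorem ordb_chi {b : ℕ} (hb : 2 ≤ b) (a : ℕ) : ordb (b + 1) (chi b a) = ordb b a := by
  simp only [ordb, pow_dvd_chi_iff hb]

/-! ### The maps `ι_m` and the level expansion -/

theorem count_map_range (F : ℕ → ℕ) (c n : ℕ) :
    ((List.range n).map F).count c = Nat.count (fun q => F q = c) n := by
  induction n with
  | zero => rfl
  | succ n ih =>
    rw [List.range_succ, List.map_append, List.count_append, ih, Nat.count_succ]
    simp [List.count_singleton]

theorem StandingHyp.blockPos_count (hSH : StandingHyp) {b n : ℕ} (hb : 2 ≤ b)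
    (hn : curl (gPrefix b n) ≤ b) : blockPos b (glueLen b) ((gPrefix b n).count b) = n := by
  rw [gPrefix_eq_map, count_map_range, ← (hSH.isBlockSeq hb).nth_eq]
  exact Nat.nth_count (gterm_eq_iff.2 hn)

theorem StandingHyp.curl_Tstr_le (hSH : StandingHyp) {m : ℕ} (hm : 1 ≤ m) (t : ℕ) :
    curl (Tstr m t) ≤ m :=
  Nat.nth_mem_of_infinite (hSH m hm).2 (t - 1)

theorem StandingHyp.Tstr_eq_piStr (hSH : StandingHyp) {m : ℕ} (hm : 2 ≤ m) (t : ℕ) :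
    Tstr m t = piStr (m + 1) ((Tstr m t).count (m + 1)) := by
  have hc := hSH.curl_Tstr_le (show 1 ≤ m by omega) t
  rw [hSH.piStr_eq (by omega), Tstr, hSH.blockPos_count (by omega) (hc.trans (Nat.le_succ m)),
    gPrefix_eq_map]

theorem StandingHyp.chi_iota (hSH : StandingHyp) {m : ℕ} (hm : 2 ≤ m) (t : ℕ) :
    chi (m + 1) (iota m t) = (Tstr m t).count (m + 1) := by
  have hdig : ∀ d ∈ Nat.digits (m + 2) ((Tstr m t).count (m + 1)), d < m + 1 := by
    intro d hd
    obtain ⟨e, he, rfl⟩ := List.getElem_of_mem hd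
    by_contra hlt
    rw [← List.getD_eq_getElem _ 0, Nat.getD_digits _ _ (by omega)] at hlt
    have := (hSH.isBlockSeq (show 2 ≤ m + 1 by omega)).le_curl_of_le_digit (by omega)
      (show 2 ≤ m + 1 by omega) (not_lt.1 hlt)
    rw [← hSH.piStr_eq (by omega), ← hSH.Tstr_eq_piStr hm] at this
    have := hSH.curl_Tstr_le (show 1 ≤ m by omega) t
    omega
  rw [chi, iota, Nat.digits_ofDigits _ (by omega) _ hdig, Nat.ofDigits_digits]
  exact fun hne => Nat.getLast_digit_ne_zero _ (Nat.digits_ne_nil_iff_ne_zero.1 hne)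

theorem StandingHyp.piStr_chi_iota (hSH : StandingHyp) {m : ℕ} (hm : 2 ≤ m) (t : ℕ) :
    piStr (m + 1) (chi (m + 1) (iota m t)) = Tstr m t := by
  rw [hSH.chi_iota hm, ← hSH.Tstr_eq_piStr hm]

theorem StandingHyp.exists_iota_eq_iff (hSH : StandingHyp) {m : ℕ} (hm : 2 ≤ m) (a : ℕ) :
    (∃ t : ℕ, 1 ≤ t ∧ iota m t = a) ↔ curl (piStr (m + 1) (chi (m + 1) a)) ≤ m := by
  constructor
  · rintro ⟨t, -, rfl⟩
    rw [hSH.piStr_chi_iota hm]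
    exact hSH.curl_Tstr_le (by omega) t
  · intro hc
    have hinf := (hSH m (by omega)).2
    obtain ⟨e, he⟩ : piLen (m + 1) (chi (m + 1) a) ∈ Set.range (glueLen m) := by
      rw [glueLen, Nat.range_nth_of_infinite hinf]
      exact hc
    have hT : Tstr m (e + 1) = piStr (m + 1) (chi (m + 1) a) := congrArg (gPrefix (m + 1)) he
    have hcount := (hSH.chi_iota hm (e + 1)).trans (congrArg (List.count (m + 1)) hT)
    have hcount' : (piStr (m + 1) (chi (m + 1) a)).count (m + 1) = chi (m + 1) a := by
      apply (blockPos_strictMono (m + 1) (glueLen (m + 1))).injective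
      rw [piStr, hSH.blockPos_count (by omega) (hc.trans (Nat.le_succ m)),
        hSH.piLen_eq (by omega)]
    refine ⟨e + 1, by omega, ?_⟩
    rw [iota, hT, hcount', digits_chi (by omega), Nat.ofDigits_digits]

theorem StandingHyp.max_two_curl_piStr (hSH : StandingHyp) {b a : ℕ} (hb : 2 ≤ b) (ha : 1 ≤ a) :
    max 2 (curl (piStr b (chi b a))) =
      max 2 (max (maxdigit b a) (curl (Tstr b (ordb b a + 1)))) := by
  have H := hSH.isBlockSeq hb
  have hT : Tstr b (ordb b a + 1) =
      (List.range (glueLen b (ordb (b + 1) (chi b a)))).map (gterm (b + 1)) := by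
    rw [ordb_chi hb, ← gPrefix_eq_map]
    rfl
  rw [hSH.piStr_eq hb, ← maxdigit_chi hb, hT]
  obtain ⟨x, hx⟩ : ∃ x, chi b a = x + 1 := ⟨chi b a - 1, by have := chi_pos hb ha; omega⟩
  rw [hx]
  refine eq_of_forall_le_iff fun k => ?_
  rcases le_or_gt k 2 with hk | hk
  · exact iff_of_true (le_max_of_le_left hk) (le_max_of_le_left hk)
  · simp only [le_max_iff, hk.not_ge, false_or, le_maxdigit_iff (show 2 ≤ b + 1 by omega)]
    constructor
    · intro hc
      rcases H.inner_or_digit_of_le_curl (by omega) hk le_rfl hc with h | ⟨-, h⟩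
      · exact Or.inr h
      · exact Or.inl (h rfl)
    · rintro (⟨e, h⟩ | h)
      · exact H.le_curl_of_le_digit (by omega) (by omega) h
      · exact H.le_curl_of_inner (by omega) le_rfl h

theorem getLastD_map_range_succ (F : ℕ → ℕ) (n d : ℕ) :
    ((List.range (n + 1)).map F).getLastD d = F n := by
  rw [List.range_succ, List.map_append]
  simp

theorem lexpAux_succ (m a k : ℕ) :
    lexpAux m a (k + 1) = lexpAux (m + 1) (iota (m + 1) (ordb (m + 1) a + 1)) k := by
  induction k with
  | zero => rfl
  | succ k ih =>
    rw [lexpAux, ih, lexpAux, show m + 1 + (k + 1) = m + 1 + 1 + k by ring]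

theorem StandingHyp.levelEnd_cases (hSH : StandingHyp) {m a : ℕ} (hm : 1 ≤ m) (ha : 1 ≤ a) :
    let a' := iota (m + 1) (ordb (m + 1) a + 1)
    (Tstr (m + 1) (ordb (m + 1) a + 1) = [] ∧ levelEnd m a = m + 1) ∨
    (1 ≤ a' ∧ piLen (m + 2) (chi (m + 2) a') < piLen (m + 1) (chi (m + 1) a) ∧
      levelEnd m a = levelEnd (m + 1) a') := by
  intro a'
  have hb : 2 ≤ m + 1 := by omega
  have H := hSH.isBlockSeq hb
  obtain ⟨x, hx⟩ : ∃ x, chi (m + 1) a = x + 1 :=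
    ⟨chi (m + 1) a - 1, by have := chi_pos hb ha; omega⟩
  have hpi := hSH.piStr_chi_iota hb (ordb (m + 1) a + 1)
  have hlen : piLen (m + 2) (chi (m + 2) a') = glueLen (m + 1) (ordb (m + 1) a) := by
    have := congrArg List.length hpi
    simp only [piStr, Tstr, gPrefix_eq_map, List.length_map, List.length_range] at this
    exact this
  have hpos : blockPos (m + 1) (glueLen (m + 1)) (x + 1) =
      blockPos (m + 1) (glueLen (m + 1)) x + 1 + glueLen (m + 1) (ordb (m + 1) a) := by
    rw [← ordb_chi hb, hx]
    rfl
  have hT : Tstr (m + 1) (ordb (m + 1) a + 1) =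
    gPrefix (m + 2) (glueLen (m + 1) (ordb (m + 1) a)) := rfl
  rcases hr : glueLen (m + 1) (ordb (m + 1) a) with _ | r
  · left
    rw [hT, hr, levelEnd, hSH.piStr_eq hb, hx, hpos, hr]
    exact ⟨rfl, (getLastD_map_range_succ _ _ _).trans (H.at_pos x)⟩
  · right
    refine ⟨?_, ?_, ?_⟩
    · by_contra h0
      have h0' : a' = 0 := by omega
      rw [h0', hSH.piLen_eq (by omega), hr] at hlen
      simp [chi, blockPos] at hlen
    · rw [hlen, hSH.piLen_eq hb, hx, hpos]
      omega
    · rw [levelEnd, levelEnd, hpi, hT, hr, hSH.piStr_eq hb, hx, hpos, hr, gPrefix_eq_map,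
        getLastD_map_range_succ, ← add_assoc, getLastD_map_range_succ, H.inner x r]
      rw [← hx, ordb_chi hb, hr]
      omega

theorem StandingHyp.max_two_curl_eq_sup (hSH : StandingHyp) (n : ℕ) :
    ∀ m a : ℕ, 1 ≤ m → 1 ≤ a → piLen (m + 1) (chi (m + 1) a) = n →
      m + 1 ≤ levelEnd m a ∧ max 2 (curl (piStr (m + 1) (chi (m + 1) a))) =
        max 2 ((Finset.Icc (m + 1) (levelEnd m a)).sup fun l => maxdigit l (lexp m a l)) := by
  induction n using Nat.strong_induction_on with
  | _ n ih =>
  intro m a hm ha hn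
  have hfirst : lexp m a (m + 1) = a := by simp [lexp, lexpAux]
  rw [hSH.max_two_curl_piStr (by omega) ha]
  rcases hSH.levelEnd_cases hm ha with ⟨h1, h2⟩ | ⟨h1, h2, h3⟩
  · rw [h1, h2, curl_nil, Finset.Icc_self, Finset.sup_singleton, hfirst]
    exact ⟨le_rfl, by omega⟩
  · obtain ⟨h4, h5⟩ := ih _ (hn ▸ h2) (m + 1) _ (by omega) h1 rfl
    rw [hSH.piStr_chi_iota (by omega)] at h5
    rw [h3, ← Finset.insert_Icc_add_one_left_eq_Icc (show m + 1 ≤ levelEnd (m + 1) _ by omega),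
      Finset.sup_insert, hfirst, max_left_comm, h5]
    refine ⟨by omega, ?_⟩
    rw [max_left_comm]
    congr 2
    refine Finset.sup_congr rfl fun l hl => ?_
    obtain ⟨k, rfl⟩ := Nat.exists_eq_add_of_le (Finset.mem_Icc.1 hl).1
    rw [lexp, lexp, show m + 1 + 1 + k - (m + 1) = k + 1 by omega,
      show m + 1 + 1 + k - (m + 1 + 1) = k by omega, lexpAux_succ]

/-- Theorem `iotam characterization`. Let `m ≥ 2`, `a ≥ 1`, with level-`m`
expansion `a_{m+1},…,a_n`.  Then `max(2, C(π^(m+1)(1,χ^(m+1)(a))))` equals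
`max(2, maxdigit_{m+1}(a_{m+1}), …, maxdigit_n(a_n))`, and `a ∈ Im(ι_m)` (equivalently
`C(π^(m+1)(1,χ^(m+1)(a))) ≤ m`) iff `maxdigit_l(a_l) ≤ m` for all `m+1 ≤ l ≤ n`. -/
theorem statement5 (hSH : StandingHyp) (m a : ℕ) (hm : 2 ≤ m) (ha : 1 ≤ a) :
    (max 2 (curl (piStr (m + 1) (chi (m + 1) a))) =
      max 2 ((Finset.Icc (m + 1) (levelEnd m a)).sup fun l => maxdigit l (lexp m a l))) ∧
    ((∃ t : ℕ, 1 ≤ t ∧ iota m t = a) ↔ curl (piStr (m + 1) (chi (m + 1) a)) ≤ m) ∧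
    ((∃ t : ℕ, 1 ≤ t ∧ iota m t = a) ↔
      ∀ l, m + 1 ≤ l → l ≤ levelEnd m a → maxdigit l (lexp m a l) ≤ m) := by
  have hsup := (hSH.max_two_curl_eq_sup _ m a (by omega) ha rfl).2
  have hiota := hSH.exists_iota_eq_iff hm a
  refine ⟨hsup, hiota, hiota.trans ?_⟩
  have h1 : curl (piStr (m + 1) (chi (m + 1) a)) ≤ m ↔
      max 2 (curl (piStr (m + 1) (chi (m + 1) a))) ≤ m := by simp [hm]
  rw [h1, hsup, max_le_iff, Finset.sup_le_iff]
  simp only [hm, true_and, Finset.mem_Icc, and_imp]
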